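/- arXiv:1204.0047 — 2 statements merged into one kernel-verified Lean document; each statement's English description precedes it below -/
import Mathlib

section
/- Let X be a real random variable with Gaussian distribution of mean μ and variance σ², where σ > 0, and let y ∈ ℝ. Then the expected improvement of X over the threshold y satisfies E[(X − y)·1_{X > y}] = (μ − y)·Φ((μ − y)/σ) + σ·φ((μ − y)/σ), where Φ denotes the cumulative distribution function of the standard normal distribution and φ denotes its probability density function. -/
open MeasureTheory ProbabilityTheory Real

/-- The probability density function of the standard normal distribution. -/
noncomputable def stdNormalPDF (t : ℝ) : ℝ :=
  (Real.sqrt (2 * Real.pi))⁻¹ * Real.exp (-t ^ 2 / 2)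

/-- The cumulative distribution function of the standard normal distribution. -/
noncomputable def stdNormalCDF (t : ℝ) : ℝ :=
  ∫ s in Set.Iic t, stdNormalPDF s

theorem stdNormalPDF_eq_gaussianPDFReal : stdNormalPDF = gaussianPDFReal 0 1 := by
  ext t
  simp [stdNormalPDF, gaussianPDFReal]

theorem integrable_stdNormalPDF : Integrable stdNormalPDF :=
  stdNormalPDF_eq_gaussianPDFReal ▸ integrable_gaussianPDFReal 0 1

theorem integrable_mul_stdNormalPDF : Integrable fun t => t * stdNormalPDF t := by
  refine ((integrable_mul_exp_neg_mul_sq (b := 1 / 2) (by norm_num)).const_mul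
    (√(2 * π))⁻¹).congr (.of_forall fun t => ?_)
  simp only [stdNormalPDF]
  rw [show -(1 / 2) * t ^ 2 = -t ^ 2 / 2 by ring]
  ring

theorem hasDerivAt_stdNormalPDF (t : ℝ) :
    HasDerivAt stdNormalPDF (-(t * stdNormalPDF t)) t := by
  have h : HasDerivAt (fun s : ℝ => -s ^ 2 / 2) (-t) t := by
    convert! ((hasDerivAt_id' t).pow 2).neg.div_const 2 using 1
    push_cast
    ring
  convert! h.exp.const_mul (√(2 * π))⁻¹ using 1
  simp only [stdNormalPDF]
  ring

theorem integral_Iic_mul_stdNormalPDF (c : ℝ) :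
    ∫ t in Set.Iic c, t * stdNormalPDF t = -stdNormalPDF c := by
  have hderiv : ∀ t ∈ Set.Iic c, HasDerivAt stdNormalPDF (-(t * stdNormalPDF t)) t :=
    fun t _ => hasDerivAt_stdNormalPDF t
  have hint : IntegrableOn (fun t => -(t * stdNormalPDF t)) (Set.Iic c) :=
    integrable_mul_stdNormalPDF.neg.integrableOn
  have h := integral_Iic_of_hasDerivAt_of_tendsto' hderiv hint
    (tendsto_zero_of_hasDerivAt_of_integrableOn_Iic hderiv hint
      integrable_stdNormalPDF.integrableOn)
  rw [integral_neg] at h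
  linarith

/-- The lower partial moment of the standard normal distribution. -/
theorem integral_indicator_sub_gaussianReal (c : ℝ) :
    ∫ z, (Set.Iio c).indicator (fun z => c - z) z ∂gaussianReal 0 1
      = c * stdNormalCDF c + stdNormalPDF c := by
  rw [integral_gaussianReal_eq_integral_smul one_ne_zero, ← stdNormalPDF_eq_gaussianPDFReal]
  simp_rw [← Set.indicator_smul_apply]
  rw [integral_indicator measurableSet_Iio, ← integral_Iic_eq_integral_Iio]
  calc ∫ z in Set.Iic c, stdNormalPDF z • (c - z)
      = ∫ z in Set.Iic c, (c * stdNormalPDF z - z * stdNormalPDF z) := by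
        congr with z
        rw [smul_eq_mul]
        ring
    _ = c * stdNormalCDF c + stdNormalPDF c := by
        rw [integral_sub (integrable_stdNormalPDF.const_mul c).integrableOn
          integrable_mul_stdNormalPDF.integrableOn, integral_const_mul,
          integral_Iic_mul_stdNormalPDF, stdNormalCDF, sub_neg_eq_add]

/-- Every Gaussian law is a reflected affine image of the standard one. -/
theorem gaussianReal_eq_map_sub_mul (μ σ : ℝ) :
    gaussianReal μ ⟨σ ^ 2, sq_nonneg σ⟩ = (gaussianReal 0 1).map fun z => μ - σ * z := by
  have h : (fun z => μ - σ * z) = (fun x => μ - x) ∘ fun z => σ * z := rfl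
  rw [h, ← Measure.map_map (by fun_prop) (by fun_prop), gaussianReal_map_const_mul,
    gaussianReal_map_const_sub, mul_one, mul_zero, sub_zero]
  rfl

/-- Closed form of the expected improvement `E[(X - y) · 1_{X > y}]` for a
Gaussian random variable `X` with mean `μ` and variance `σ²`. -/
theorem expected_improvement_gaussian
    {Ω : Type*} [MeasurableSpace Ω] (P : Measure Ω) [IsProbabilityMeasure P]
    (X : Ω → ℝ) (μ σ y : ℝ) (hσ : 0 < σ)
    (hX : Measure.map X P = gaussianReal μ ⟨σ ^ 2, sq_nonneg σ⟩) :
    ∫ ω, Set.indicator {ω | y < X ω} (fun ω => X ω - y) ω ∂P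
      = (μ - y) * stdNormalCDF ((μ - y) / σ) + σ * stdNormalPDF ((μ - y) / σ) := by
  have hXm : AEMeasurable X P := by
    refine AEMeasurable.of_map_ne_zero ?_
    rw [hX, gaussianReal_eq_map_sub_mul]
    exact (Measure.isProbabilityMeasure_map (by fun_prop)).ne_zero
  have hmeas : Measurable ((Set.Ioi y).indicator fun x => x - y) :=
    (measurable_id.sub_const y).indicator measurableSet_Ioi
  calc ∫ ω, Set.indicator {ω | y < X ω} (fun ω => X ω - y) ω ∂P
      = ∫ x, (Set.Ioi y).indicator (fun x => x - y) x ∂(P.map X) :=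
        (integral_map hXm hmeas.aestronglyMeasurable).symm
    _ = ∫ z, (Set.Ioi y).indicator (fun x => x - y) (μ - σ * z) ∂gaussianReal 0 1 := by
        rw [hX, gaussianReal_eq_map_sub_mul,
          integral_map (by fun_prop) hmeas.aestronglyMeasurable]
    _ = ∫ z, σ * (Set.Iio ((μ - y) / σ)).indicator (fun z => (μ - y) / σ - z) z
          ∂gaussianReal 0 1 := by
        congr with z
        have hiff : y < μ - σ * z ↔ z < (μ - y) / σ := by
          rw [lt_div_iff₀ hσ, lt_sub_comm, mul_comm]
        simp only [Set.indicator_apply, Set.mem_Ioi, Set.mem_Iio, hiff]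
        split_ifs
        · field_simp
          ring
        · simp
    _ = (μ - y) * stdNormalCDF ((μ - y) / σ) + σ * stdNormalPDF ((μ - y) / σ) := by
        rw [integral_const_mul, integral_indicator_sub_gaussianReal]
        field_simp
end

section
/- Let f : ℝᵈ → ℝ be Lipschitz continuous with constant L > 0 on a set D ⊆ ℝᵈ (with respect to the Euclidean norm), let x* ∈ D satisfy f(x*) = M and f(x) ≤ M for all x ∈ D. Let x₁, …, x_n ∈ D be any finite collection of points, and for each i set r_{x_i} = (M − f(x_i))/L. Then x* belongs to D \ ⋃_{i=1}^{n} S(x_i, r_{x_i}), where S(x_i, r_{x_i}) is the open Euclidean ball of radius r_{x_i} centered at x_i. -/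
open Metric

/-- Correctness of the shrunken search space: if `f` is `L`-Lipschitz on `D` with
maximum value `M = f x*` attained at `x* ∈ D`, then for any finite collection of
sample points `x₁, …, x_n ∈ D`, the maximizer `x*` belongs to
`D \ ⋃ i, S(xᵢ, r_{xᵢ})` where `r_{xᵢ} = (M - f xᵢ)/L`. -/
theorem maximizer_in_shrunken_space
    (d : ℕ) (D : Set (EuclideanSpace ℝ (Fin d))) (f : EuclideanSpace ℝ (Fin d) → ℝ)
    (L M : ℝ) (hL : 0 < L)
    (hLip : ∀ x₁ ∈ D, ∀ x₂ ∈ D, |f x₁ - f x₂| ≤ L * ‖x₁ - x₂‖)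
    (xstar : EuclideanSpace ℝ (Fin d)) (hxstar : xstar ∈ D) (hM : f xstar = M)
    (hmax : ∀ x ∈ D, f x ≤ M)
    (n : ℕ) (x : Fin n → EuclideanSpace ℝ (Fin d)) (hx : ∀ i, x i ∈ D) :
    xstar ∈ D \ ⋃ i : Fin n, Metric.ball (x i) ((M - f (x i)) / L) := by
  refine ⟨hxstar, fun hmem => ?_⟩
  obtain ⟨i, hi⟩ := Set.mem_iUnion.mp hmem
  rw [Metric.mem_ball, dist_eq_norm, lt_div_iff₀' hL, ← hM] at hi
  exact absurd ((le_abs_self _).trans (hLip xstar hxstar (x i) (hx i))) hi.not_ge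
end
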